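/- Let n ∈ ℕ, m ≥ 1 an integer, f, g : 𝔽₂ⁿ → 𝔽₂, and y ∈ 𝔽₂ⁿ. Let h : 𝔽₂ⁿ → 𝔽₂ be the linear function h(x) = x·y. Then the m-Forrelation satisfies Φ^(m)_{h,f,g} = 2^(-n) · ζ_m^(−wt(y)) · C^(m)_{f,g}(y). -/

import Mathlib

open Finset

noncomputable section

/-- Sign character: `(-1)^v ∈ ℂ` for `v ∈ 𝔽₂`. -/
def sgn (v : ZMod 2) : ℂ := if v = 0 then 1 else -1

/-- Hamming weight of `x ∈ 𝔽₂ⁿ`. -/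
def wt {n : ℕ} (x : Fin n → ZMod 2) : ℕ := (Finset.univ.filter (fun i => x i = 1)).card

/-- Dot product `x·y = ⊕ᵢ xᵢyᵢ ∈ 𝔽₂`. -/
def dotp {n : ℕ} (x y : Fin n → ZMod 2) : ZMod 2 := ∑ i, x i * y i

/-- `x⊙y ∈ ℕ`: number of indices with `xᵢ = yᵢ = 1`. -/
def odot {n : ℕ} (x y : Fin n → ZMod 2) : ℕ :=
  (Finset.univ.filter (fun i => x i = 1 ∧ y i = 1)).card

/-- `ζ_m = exp(2πi/m)`. -/
def zeta (m : ℕ) : ℂ := Complex.exp (2 * Real.pi * Complex.I / m)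

/-- The `m`-Hadamard transform of `f` at `ω`. -/
def mHad (m : ℕ) {n : ℕ} (f : (Fin n → ZMod 2) → ZMod 2) (ω : Fin n → ZMod 2) : ℂ :=
  ((Real.sqrt 2 : ℂ) ^ n)⁻¹ *
    ∑ x : Fin n → ZMod 2, sgn (f x + dotp x ω) * zeta m ^ wt x

/-- The `m`-crosscorrelation of `f` and `g` at `y`. -/
def mCross (m : ℕ) {n : ℕ} (f g : (Fin n → ZMod 2) → ZMod 2) (y : Fin n → ZMod 2) : ℂ :=
  ∑ x : Fin n → ZMod 2, sgn (f x + g (x + y)) * (zeta m ^ 2) ^ odot x y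

/-- The (3-fold) `m`-Forrelation of `f₁, f₂, f₃`. -/
def mForr (m : ℕ) {n : ℕ} (f₁ f₂ f₃ : (Fin n → ZMod 2) → ZMod 2) : ℂ :=
  ((2 : ℂ) ^ n)⁻¹ *
    ∑ x : Fin n → ZMod 2, sgn (f₁ x) * mHad m f₂ x * (starRingEnd ℂ) (mHad m f₃ x)

/-- The Walsh–Hadamard transform of `f` at `ω`. -/
def walsh {n : ℕ} (f : (Fin n → ZMod 2) → ZMod 2) (ω : Fin n → ZMod 2) : ℂ :=
  ((Real.sqrt 2 : ℂ) ^ n)⁻¹ * ∑ x : Fin n → ZMod 2, sgn (f x + dotp x ω)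

/-- The nega-Hadamard transform of `f` at `ω`. -/
def negaHad {n : ℕ} (f : (Fin n → ZMod 2) → ZMod 2) (ω : Fin n → ZMod 2) : ℂ :=
  ((Real.sqrt 2 : ℂ) ^ n)⁻¹ *
    ∑ x : Fin n → ZMod 2, sgn (f x + dotp x ω) * Complex.I ^ wt x

/-- The elementary symmetric quadratic Boolean function `s₂`. -/
def s2 {n : ℕ} (x : Fin n → ZMod 2) : ZMod 2 :=
  ∑ i : Fin n, ∑ j ∈ Finset.univ.filter (fun j => i < j), x i * x j

/-- The linear function `L_u(x) = ⊕ᵢ xᵢ · (⊕_{j ≠ i} uⱼ)`. -/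
def Lfun {n : ℕ} (u x : Fin n → ZMod 2) : ZMod 2 :=
  ∑ i : Fin n, x i * ∑ j ∈ Finset.univ.filter (fun j => j ≠ i), u j

end

theorem sgn_add (a b : ZMod 2) : sgn (a + b) = sgn a * sgn b := by
  have : ∀ a b : ZMod 2, (a = 0 ∨ a = 1) ∧ (b = 0 ∨ b = 1) := by decide
  have h2 : (1 + 1 : ZMod 2) = 0 := by decide
  obtain ⟨rfl | rfl, rfl | rfl⟩ := this a b <;> simp [sgn, h2]

theorem sgn_sum {ι : Type*} (s : Finset ι) (a : ι → ZMod 2) :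
    sgn (∑ i ∈ s, a i) = ∏ i ∈ s, sgn (a i) := by
  classical
  induction s using Finset.induction_on with
  | empty => simp [sgn]
  | insert i s hi ih => rw [Finset.sum_insert hi, Finset.prod_insert hi, sgn_add, ih]

theorem conj_sgn (a : ZMod 2) : (starRingEnd ℂ) (sgn a) = sgn a := by
  unfold sgn; split_ifs <;> simp

theorem conj_zeta (m : ℕ) : (starRingEnd ℂ) (zeta m) = (zeta m)⁻¹ := by
  unfold zeta
  rw [← Complex.exp_conj, ← Complex.exp_neg]
  congr 1
  have h2 : (starRingEnd ℂ) 2 = 2 := Complex.conj_ofNat 2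
  simp [neg_div, h2]

theorem sum_sgn_one (a : ZMod 2) : ∑ b : ZMod 2, sgn (a * b) = if a = 0 then 2 else 0 := by
  have : ∀ a : ZMod 2, a = 0 ∨ a = 1 := by decide
  have hu : (Finset.univ : Finset (ZMod 2)) = {0, 1} := by decide
  rw [hu]
  obtain rfl | rfl := this a <;> norm_num [sgn]

theorem sum_sgn {n : ℕ} (a : Fin n → ZMod 2) :
    ∑ w : Fin n → ZMod 2, sgn (dotp a w) = if a = 0 then (2 : ℂ) ^ n else 0 := by
  simp only [dotp, sgn_sum]
  have := (Finset.prod_univ_sum (fun _ : Fin n => (Finset.univ : Finset (ZMod 2)))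
    (fun i b => sgn (a i * b))).symm
  rw [Fintype.piFinset_univ] at this
  rw [this]
  simp only [sum_sgn_one]
  split_ifs with h
  · simp [h]
  · obtain ⟨i, hi⟩ := Function.ne_iff.mp h
    exact Finset.prod_eq_zero (Finset.mem_univ i) (if_neg hi)

theorem wt_add {n : ℕ} (x y : Fin n → ZMod 2) :
    wt (x + y) + 2 * odot x y = wt x + wt y := by
  simp only [wt, odot, Finset.card_filter, Finset.mul_sum, ← Finset.sum_add_distrib]
  refine Finset.sum_congr rfl fun i _ => ?_
  have : ∀ a b : ZMod 2, (if a + b = 1 then 1 else 0) + 2 * (if a = 1 ∧ b = 1 then 1 else 0)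
    = (if a = 1 then 1 else 0) + (if b = 1 then 1 else 0) := by decide
  exact this (x i) (y i)

theorem zeta_ne (m : ℕ) : zeta m ≠ 0 := Complex.exp_ne_zero _

theorem dotp_add {n : ℕ} (x y w : Fin n → ZMod 2) : dotp (x + y) w = dotp x w + dotp y w := by
  simp [dotp, add_mul, Finset.sum_add_distrib]

theorem dotp_symm {n : ℕ} (x y : Fin n → ZMod 2) : dotp x y = dotp y x := by
  simp [dotp, mul_comm]

theorem zmod_iff {n : ℕ} (x y z : Fin n → ZMod 2) : y + x + z = 0 ↔ x + y = z := by
  have : ∀ a b c : ZMod 2, b + a + c = 0 ↔ a + b = c := by decide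
  simp only [funext_iff]
  exact forall_congr' fun i => this (x i) (y i) (z i)

theorem stmt5 (n m : ℕ) (hm : 1 ≤ m) (f g h : (Fin n → ZMod 2) → ZMod 2)
    (y : Fin n → ZMod 2) (hh : ∀ x, h x = dotp x y) :
    mForr m h f g = ((2 : ℂ) ^ n)⁻¹ * zeta m ^ (-(wt y : ℤ)) * mCross m f g y := by
  have hs : ((Real.sqrt 2 : ℂ) ^ n)⁻¹ * ((Real.sqrt 2 : ℂ) ^ n)⁻¹ = ((2 : ℂ) ^ n)⁻¹ := by
    rw [← mul_inv, ← mul_pow, ← Complex.ofReal_mul, Real.mul_self_sqrt (by norm_num)]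
    simp
  have h2 : ((2 : ℂ) ^ n) ≠ 0 := pow_ne_zero _ two_ne_zero
  unfold mForr
  rw [mul_assoc]
  congr 1
  have key : ∀ w : Fin n → ZMod 2,
      sgn (h w) * mHad m f w * (starRingEnd ℂ) (mHad m g w) =
      ∑ x : Fin n → ZMod 2, ∑ z : Fin n → ZMod 2,
        ((2 : ℂ) ^ n)⁻¹ * (sgn (f x) * sgn (g z) * zeta m ^ wt x * (zeta m)⁻¹ ^ wt z) *
          sgn (dotp (y + x + z) w) := by
    intro w
    simp only [mHad, map_mul, map_sum, map_inv₀, map_pow, Complex.conj_ofReal, conj_sgn,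
      conj_zeta, hh, ← hs]
    rw [dotp_symm w y]
    rw [show ∀ a b c d e : ℂ, a * (b * c) * (d * e) = a * b * d * (c * e) by intros; ring,
      Finset.sum_mul_sum, Finset.mul_sum]
    refine Finset.sum_congr rfl fun x _ => ?_
    rw [Finset.mul_sum]
    refine Finset.sum_congr rfl fun z _ => ?_
    simp only [dotp_add, sgn_add]
    ring
  simp only [key]
  rw [Finset.sum_comm]
  unfold mCross
  rw [Finset.mul_sum]
  refine Finset.sum_congr rfl fun x _ => ?_
  rw [Finset.sum_comm]
  simp only [← Finset.mul_sum, sum_sgn, zmod_iff]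
  simp only [mul_ite, mul_zero, Finset.sum_ite_eq, Finset.mem_univ, if_true]
  have hz := zeta_ne m
  have e : zeta m ^ wt (x + y) * (zeta m ^ 2) ^ odot x y = zeta m ^ wt x * zeta m ^ wt y := by
    rw [← pow_mul, ← pow_add, ← pow_add, wt_add]
  rw [sgn_add, zpow_neg, zpow_natCast, inv_pow]
  field_simp
  linear_combination (-(sgn (f x) * sgn (g (x + y)))) * e
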